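/- Let n and t be positive integers with 1 ≤ t ≤ (n−1)/2, and let k be a nonnegative integer. Then there exists an integer {k}-domination function f of the circulant graph G(n; {1,2,…,t}) with Σ_{v ∈ V(G)} f(v) ≤ ⌈kn/(2t+1)⌉; equivalently, γ_k(G(n;{1,…,t})) ≤ ⌈kn/(2t+1)⌉. -/

import Mathlib

/-- The circulant graph `G(n; D)` on `ℤ_n`: vertices `i ≠ j` are adjacent iff
`min {|i - j|, n - |i - j|} ∈ D`. -/
def circulantGraph (n : ℕ) (D : Finset ℕ) : SimpleGraph (ZMod n) where
  Adj i j := i ≠ j ∧ min (i - j).val (j - i).val ∈ D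
  symm := by
    refine ⟨?_⟩
    intro i j h
    exact ⟨h.1.symm, by rw [min_comm]; exact h.2⟩
  loopless := by
    refine ⟨?_⟩
    intro i h
    exact h.1 rfl

instance (n : ℕ) (D : Finset ℕ) : DecidableRel (circulantGraph n D).Adj := fun i j =>
  decidable_of_iff (i ≠ j ∧ min (i - j).val (j - i).val ∈ D) Iff.rfl

/-- `f` is an integer `{k}`-domination function: the sum of `f` over each closed
neighborhood is at least `k`. -/
def IsKDomFun (n : ℕ) [NeZero n] (D : Finset ℕ) (k : ℕ) (f : ZMod n → ℕ) : Prop :=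
  ∀ v : ZMod n,
    k ≤ ∑ u ∈ Finset.univ.filter (fun u => u = v ∨ (circulantGraph n D).Adj v u), f u

/-- The integer `{k}`-domination number `γ_k(G(n; D))`. -/
noncomputable def gammaK (n : ℕ) [NeZero n] (D : Finset ℕ) (k : ℕ) : ℕ :=
  sInf {s | ∃ f : ZMod n → ℕ, IsKDomFun n D k f ∧ s = ∑ v, f v}

/-- The increments of `i ↦ ⌊i * s / n⌋`: the balanced (Sturmian) distribution of mass `s` over
`n` consecutive integers. -/
def balancedIncrement (n s i : ℕ) : ℕ := (i + 1) * s / n - i * s / n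

lemma sum_range_balancedIncrement (n s a m : ℕ) :
    ∑ j ∈ Finset.range m, balancedIncrement n s (a + j) = (a + m) * s / n - a * s / n := by
  have hmono : Monotone fun j => (a + j) * s / n := fun x y h =>
    Nat.div_le_div_right (Nat.mul_le_mul_right _ (Nat.add_le_add_left h _))
  simpa [balancedIncrement, add_assoc] using Finset.sum_range_tsub hmono m

lemma balancedIncrement_add_mul {n : ℕ} (hn : 0 < n) (s i q : ℕ) :
    balancedIncrement n s (i + n * q) = balancedIncrement n s i := by
  have h (x : ℕ) : (x + n * q) * s / n = x * s / n + q * s := by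
    rw [add_mul, mul_assoc, Nat.add_mul_div_left _ _ hn]
  rw [balancedIncrement, add_right_comm, h, h, balancedIncrement, Nat.add_sub_add_right]

lemma balancedIncrement_mod {n : ℕ} (hn : 0 < n) (s i : ℕ) :
    balancedIncrement n s (i % n) = balancedIncrement n s i := by
  conv_rhs => rw [← Nat.mod_add_div i n]
  exact (balancedIncrement_add_mul hn s _ _).symm

lemma le_sum_range_balancedIncrement {n s m k : ℕ} (hn : 0 < n) (h : k * n ≤ m * s) (a : ℕ) :
    k ≤ ∑ j ∈ Finset.range m, balancedIncrement n s (a + j) := by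
  rw [sum_range_balancedIncrement]
  have h1 : k ≤ m * s / n := (Nat.le_div_iff_mul_le hn).2 h
  have h2 : a * s / n + m * s / n ≤ (a + m) * s / n := by
    rw [add_mul]
    exact Nat.div_add_div_le_add_div
  omega

lemma sum_val_balancedIncrement (n s : ℕ) [NeZero n] :
    ∑ v : ZMod n, balancedIncrement n s v.val = s := by
  have hn : 0 < n := NeZero.pos n
  have h : ∑ v : ZMod n, balancedIncrement n s v.val
      = ∑ j ∈ Finset.range n, balancedIncrement n s j := by
    refine Finset.sum_nbij ZMod.val (fun v _ => Finset.mem_range.2 v.val_lt)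
      (ZMod.val_injective n).injOn (fun j hj => ?_) fun _ _ => rfl
    exact ⟨j, by simp, ZMod.val_cast_of_lt (by simpa using hj)⟩
  rw [h]
  simpa [Nat.mul_div_cancel_left _ hn] using sum_range_balancedIncrement n s 0 n

/-- A vertex at cyclic distance between `1` and `t` is adjacent in `G(n; {1, …, t})`. -/
lemma circulantGraph_Icc_adj {n t d : ℕ} [NeZero n] {u v : ZMod n} (hd : 0 < d) (hdt : d ≤ t)
    (htn : t < n) (h : v - u = d) : (circulantGraph n (Finset.Icc 1 t)).Adj v u := by
  have hval : (v - u).val = d := by rw [h, ZMod.val_cast_of_lt (by omega)]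
  have hne : v ≠ u := by
    rintro rfl
    simp at hval
    omega
  have hpos : 0 < (u - v).val := ZMod.val_pos.2 (sub_ne_zero.2 hne.symm)
  exact ⟨hne, Finset.mem_Icc.2 ⟨le_min (by omega) hpos, (min_le_left _ _).trans (by omega)⟩⟩

lemma isKDomFun_balancedIncrement {n t k s : ℕ} [NeZero n] (htn : 2 * t + 1 ≤ n)
    (h : k * n ≤ (2 * t + 1) * s) :
    IsKDomFun n (Finset.Icc 1 t) k fun v => balancedIncrement n s v.val := by
  intro v
  have hn : 0 < n := NeZero.pos n
  set a := v.val + n - t with ha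
  have hcast : (a : ZMod n) = v - t := by
    rw [ha, Nat.cast_sub (by omega)]
    simp
  refine (le_sum_range_balancedIncrement hn h a).trans ?_
  have hinj : Set.InjOn (fun j : ℕ => ((a + j : ℕ) : ZMod n)) (Finset.range (2 * t + 1)) := by
    intro i hi j hj hij
    have hi' : i < 2 * t + 1 := by simpa using hi
    have hj' : j < 2 * t + 1 := by simpa using hj
    exact (Nat.ModEq.add_left_cancel' a ((ZMod.natCast_eq_natCast_iff _ _ _).1 hij)).eq_of_lt_of_lt
      (by omega) (by omega)
  have hsum : ∑ j ∈ Finset.range (2 * t + 1), balancedIncrement n s (a + j)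
      = ∑ u ∈ (Finset.range (2 * t + 1)).image (fun j : ℕ => ((a + j : ℕ) : ZMod n)),
          balancedIncrement n s u.val := by
    rw [Finset.sum_image hinj]
    refine Finset.sum_congr rfl fun j _ => ?_
    rw [ZMod.val_natCast, balancedIncrement_mod hn]
  rw [hsum]
  refine Finset.sum_le_sum_of_subset fun u hu => ?_
  obtain ⟨j, hj, rfl⟩ := Finset.mem_image.1 hu
  rw [Finset.mem_range] at hj
  rw [Finset.mem_filter]
  refine ⟨Finset.mem_univ _, ?_⟩
  rcases lt_trichotomy j t with hlt | rfl | hgt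
  · right
    refine circulantGraph_Icc_adj (d := t - j) (by omega) (by omega) (by omega) ?_
    rw [Nat.cast_sub hlt.le, Nat.cast_add, hcast]
    ring
  · left
    rw [Nat.cast_add, hcast]
    ring
  · right
    refine (circulantGraph_Icc_adj (d := j - t) (by omega) (by omega) (by omega) ?_).symm
    rw [Nat.cast_sub hgt.le, Nat.cast_add, hcast]
    ring

theorem gammaK_le (n t k : ℕ) [NeZero n] (hn : 0 < n) (ht1 : 1 ≤ t)
    (ht2 : t ≤ (n - 1) / 2) :
    (∃ f : ZMod n → ℕ, IsKDomFun n (Finset.Icc 1 t) k f ∧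
        ∑ v, f v ≤ ⌈(k * n : ℚ) / (2 * t + 1)⌉₊) ∧
      gammaK n (Finset.Icc 1 t) k ≤ ⌈(k * n : ℚ) / (2 * t + 1)⌉₊ := by
  set s := ⌈(k * n : ℚ) / (2 * t + 1)⌉₊
  have hks : k * n ≤ (2 * t + 1) * s := by
    have h : (k * n : ℚ) / (2 * t + 1) ≤ s := Nat.le_ceil _
    rw [div_le_iff₀ (by positivity), mul_comm (s : ℚ)] at h
    exact_mod_cast h
  have hdom := isKDomFun_balancedIncrement (by omega) hks
  have hsum := sum_val_balancedIncrement n s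
  exact ⟨⟨_, hdom, hsum.le⟩, Nat.sInf_le ⟨_, hdom, hsum.symm⟩⟩
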